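/- Let O be a theory, χ a sentence, and φ an S_A-sentence. Then φ is a strongest necessary condition of χ under O on S_A if and only if ¬φ is a weakest sufficient condition of ¬χ under O on S_A. -/

import Mathlib

open FirstOrder Language

namespace Abduction

variable {L' L : FirstOrder.Language}

/-- An `L`-sentence is an `S_A`-sentence (w.r.t. the language homomorphism `ι`)
if it is the image under `ι` of some `L'`-sentence. -/
def IsSA (ι : L' →ᴸ L) (φ : L.Sentence) : Prop :=
  ∃ β : L'.Sentence, ι.onSentence β = φ

/-- `V` is a uniform interpolant of `O` for the abducible signature given by `ι`:
`V` is an `S_A`-theory and for every `S_A`-sentence `β`, `O ⊨ β` iff `V ⊨ β`. -/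
def IsUniformInterpolant (ι : L' →ᴸ L) (O V : L.Theory) : Prop :=
  (∀ β ∈ V, IsSA ι β) ∧ ∀ φ : L.Sentence, IsSA ι φ → ((O ⊨ᵇ φ) ↔ (V ⊨ᵇ φ))

/-- Finite disjunction `b 0 ∨ ... ∨ b (n-1)`; the empty disjunction is `⊥`. -/
def disj {L : FirstOrder.Language} : {n : ℕ} → (Fin n → L.Sentence) → L.Sentence
  | 0, _ => ⊥
  | _ + 1, b => b 0 ⊔ disj fun i => b i.succ

/-- Disjunction of a list of sentences; the empty disjunction is `⊥`. -/
def ldisj {L : FirstOrder.Language} : List L.Sentence → L.Sentence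
  | [] => ⊥
  | φ :: rest => φ ⊔ ldisj rest

open Classical in
/-- Single-pass redundancy elimination: go through the enumeration, removing an axiom
if it is entailed by `O` together with the remaining axioms. -/
noncomputable def spre (O : L.Theory) : List L.Sentence → L.Theory → L.Theory
  | [], R => R
  | β :: rest, R => spre O rest (if (O ∪ (R \ {β})) ⊨ᵇ β then R \ {β} else R)


/-- An `S_A`-sentence `φ` is a strongest necessary condition of `χ` under `O` on `S_A`. -/
def IsSNC (ι : L' →ᴸ L) (O : L.Theory) (χ φ : L.Sentence) : Prop :=
  IsSA ι φ ∧ ((O ∪ {χ}) ⊨ᵇ φ) ∧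
    ∀ φ' : L.Sentence, IsSA ι φ' → ((O ∪ {χ}) ⊨ᵇ φ') → ((O ∪ {φ}) ⊨ᵇ φ')

/-- An `S_A`-sentence `φ` is a weakest sufficient condition of `χ` under `O` on `S_A`. -/
def IsWSC (ι : L' →ᴸ L) (O : L.Theory) (χ φ : L.Sentence) : Prop :=
  IsSA ι φ ∧ ((O ∪ {φ}) ⊨ᵇ χ) ∧
    ∀ φ' : L.Sentence, IsSA ι φ' → ((O ∪ {φ'}) ⊨ᵇ χ) → ((O ∪ {φ'}) ⊨ᵇ φ)

theorem IsSA.not {ι : L' →ᴸ L} {φ : L.Sentence} (h : IsSA ι φ) : IsSA ι φ.not := by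
  obtain ⟨β, rfl⟩ := h
  exact ⟨β.not, rfl⟩

/-- The semantic deduction theorem. -/
theorem union_singleton_models_iff.{u, v} {L : FirstOrder.Language.{u, v}} {O : L.Theory}
    {φ ψ : L.Sentence} :
    ((O ∪ {φ}) ⊨ᵇ ψ) ↔ ∀ M : Theory.ModelType.{u, v, max u v} O, M ⊨ φ → M ⊨ ψ := by
  rw [Theory.models_sentence_iff]
  constructor
  · intro h M hφ
    have : M ⊨ O ∪ {φ} := Theory.model_union_iff.2 ⟨M.is_model, Theory.model_singleton_iff.2 hφ⟩
    exact h (Theory.ModelType.of _ M)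
  · intro h M
    obtain ⟨hO, hφ⟩ := Theory.model_union_iff.1 M.is_model
    exact h (Theory.ModelType.of O M) (Theory.model_singleton_iff.1 hφ)

theorem union_singleton_models_not_comm {O : L.Theory} {φ ψ : L.Sentence} :
    ((O ∪ {φ}) ⊨ᵇ ψ.not) ↔ ((O ∪ {ψ}) ⊨ᵇ φ.not) := by
  simp only [union_singleton_models_iff, Sentence.realize_not]
  exact forall_congr' fun _ => imp_not_comm

theorem union_singleton_not_models_not_iff {O : L.Theory} {φ ψ : L.Sentence} :
    ((O ∪ {ψ.not}) ⊨ᵇ φ.not) ↔ ((O ∪ {φ}) ⊨ᵇ ψ) := by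
  simp only [union_singleton_models_iff, Sentence.realize_not]
  exact forall_congr' fun _ => not_imp_not

/-- `φ` is a strongest necessary condition of `χ` under `O` on `S_A` iff
`¬φ` is a weakest sufficient condition of `¬χ` under `O` on `S_A`. -/
theorem snc_iff_wsc_of_neg
    (ι : L' →ᴸ L) (O : L.Theory) (χ φ : L.Sentence) (hφ : IsSA ι φ) :
    IsSNC ι O χ φ ↔ IsWSC ι O χ.not φ.not := by
  constructor
  · rintro ⟨-, hχ, hmin⟩
    refine ⟨hφ.not, union_singleton_not_models_not_iff.2 hχ, fun φ' hφ' h => ?_⟩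
    exact union_singleton_models_not_comm.1
      (hmin φ'.not hφ'.not (union_singleton_models_not_comm.1 h))
  · rintro ⟨-, hχ, hmax⟩
    refine ⟨hφ, union_singleton_not_models_not_iff.1 hχ, fun φ' hφ' h => ?_⟩
    exact union_singleton_not_models_not_iff.1
      (hmax φ'.not hφ'.not (union_singleton_not_models_not_iff.2 h))

end Abduction
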